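/- For every n ≥ 1, ∂_{w[1,n]}( X_1^{n−1} X_2^{n−2} ··· X_{n−1}^1 X_n^0 ) = (−1)^{n(n−1)/2}. Equivalently, for the opposite-sign Demazure operators ∂'_i(P) = (P − s_i(P))/(X_i − X_{i+1}) (which also satisfy the braid relations, so that ∂'_w is well-defined via reduced expressions), one has ∂'_{w[1,n]}( X_1^{n−1} X_2^{n−2} ··· X_{n−1} ) = 1. -/

import Mathlib

open scoped BigOperators

namespace Dem

/-- The polynomial ring `ℤ[X_1, …, X_n]` (0-based variables). -/
abbrev R (n : ℕ) := MvPolynomial (Fin n) ℤ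

/-- `D` is the family of Demazure (BGG) operators `∂_i` (0-based), characterized
by `(X_{i+1} - X_i) · ∂_i P = P - s_i(P)`. -/
def IsDemFamily {n : ℕ} (D : ℕ → R n → R n) : Prop :=
  ∀ (i : ℕ) (h : i + 1 < n) (P : R n),
    (MvPolynomial.X (⟨i + 1, h⟩ : Fin n) - MvPolynomial.X ⟨i, by omega⟩) * D i P
      = P - MvPolynomial.rename (Equiv.swap (⟨i, by omega⟩ : Fin n) ⟨i + 1, h⟩) P

/-- `∂_w = ∂_{i_1} ∘ ⋯ ∘ ∂_{i_r}` for a word `l = [i_1, …, i_r]` (rightmost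
applied first). -/
def applyWord {n : ℕ} (D : ℕ → R n → R n) (l : List ℕ) (P : R n) : R n :=
  l.foldr (fun i Q => D i Q) P

/-- The permutation of `Fin n` given by a word in the simple transpositions. -/
def permOfWord (n : ℕ) (l : List ℕ) : Equiv.Perm (Fin n) :=
  (l.map fun i =>
    if h : i + 1 < n then Equiv.swap (⟨i, by omega⟩ : Fin n) ⟨i + 1, h⟩ else 1).prod

/-- `l` is a reduced word for the permutation `w`. -/
def IsReducedWordFor (n : ℕ) (l : List ℕ) (w : Equiv.Perm (Fin n)) : Prop :=
  (∀ i ∈ l, i + 1 < n) ∧ permOfWord n l = w ∧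
    ∀ l' : List ℕ, (∀ i ∈ l', i + 1 < n) → permOfWord n l' = w → l.length ≤ l'.length

/-- The standard reduced word for the longest element of `S_m` (0-based). -/
def longWord (m : ℕ) : List ℕ :=
  (List.range m).foldr (fun j acc => (List.range j).reverse ++ acc) []

/-- The set of variables `X_{lo+1}, …, X_n` (0-based indices `≥ lo`). -/
def varsFrom (n lo : ℕ) : Finset (Fin n) :=
  Finset.univ.filter fun a : Fin n => lo ≤ a.val

/-- The set of variables `X_1, …, X_m` (0-based indices `< m`). -/
def varsUpto (n m : ℕ) : Finset (Fin n) :=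
  Finset.univ.filter fun a : Fin n => a.val < m

/-- Elementary symmetric polynomial of degree `m` in the variables of `s`. -/
noncomputable def eOn {n : ℕ} (s : Finset (Fin n)) (m : ℕ) : R n :=
  ∑ T ∈ s.powersetCard m, ∏ a ∈ T, MvPolynomial.X a

/-- Complete homogeneous symmetric polynomial of degree `j` in the variables of
`s`. -/
noncomputable def hOn {n : ℕ} (s : Finset (Fin n)) (j : ℕ) : R n :=
  ∑ d ∈ s.sym j, (Multiset.map MvPolynomial.X (d : Multiset (Fin n))).prod

/-- `P` is symmetric in the variables with (0-based) index `≥ lo`. -/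
def SymFrom {n : ℕ} (lo : ℕ) (P : R n) : Prop :=
  ∀ a b : Fin n, lo ≤ a.val → lo ≤ b.val →
    MvPolynomial.rename (Equiv.swap a b) P = P

/-- The monomial symmetric polynomial in the first `c` of the `n` variables,
attached to the exponent vector `w` (the sum of the distinct monomials in the
`S_c`-orbit of `X_1^{w_1} ⋯ X_c^{w_c}`). -/
noncomputable def msymBlock {n : ℕ} (c : ℕ) (w : Fin c → ℕ) : R n :=
  ∑ g ∈ Finset.image
      (fun σ : Equiv.Perm (Fin c) =>
        fun i : Fin n => if h : i.val < c then w (σ ⟨i.val, h⟩) else 0)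
      Finset.univ,
    ∏ i, MvPolynomial.X i ^ g i

end Dem

namespace Dem

open MvPolynomial

variable {n : ℕ}

/-- The pairs `(x, y)` with `x < y`. -/
def ltPairs (n : ℕ) : Finset (Fin n × Fin n) :=
  Finset.univ.filter fun p => p.1 < p.2

/-- The inversions of `v`, recorded by the values exchanged. -/
def invPairs (v : Equiv.Perm (Fin n)) : Finset (Fin n × Fin n) :=
  (ltPairs n).filter fun p => v⁻¹ p.2 < v⁻¹ p.1

/-- The product of the differences of the values exchanged by the inversions of `v`. -/
def invProd (v : Equiv.Perm (Fin n)) : ℤ :=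
  ∏ p ∈ invPairs v, ((p.2.val : ℤ) - p.1.val)

/-- The simple transposition exchanging `i` and `i + 1`. -/
abbrev simpleSwap (i : ℕ) (h : i + 1 < n) : Equiv.Perm (Fin n) :=
  Equiv.swap ⟨i, by omega⟩ ⟨i + 1, h⟩

/-- The opposite-sign Demazure operators, with `(X_i - X_{i+1}) · ∂'_i P = P - s_i P`. -/
def IsOppDemFamily (D : ℕ → R n → R n) : Prop :=
  ∀ (i : ℕ) (h : i + 1 < n) (P : R n),
    (X (⟨i, by omega⟩ : Fin n) - X ⟨i + 1, h⟩) * D i P = P - rename (simpleSwap i h) P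

/-- The staircase monomial deformed so as to vanish at all points `(v(1), …, v(n))`
with `v` a permutation other than the longest one. -/
noncomputable def deformedStaircase (n : ℕ) : R n :=
  ∏ p ∈ ltPairs n, (X (Fin.rev p.2) - C (p.1.val : ℤ))

/-- Evaluation at the point `(v(1), …, v(n))`. -/
noncomputable def evalPerm (v : Equiv.Perm (Fin n)) : R n →+* ℤ :=
  eval fun i => ((v i).val : ℤ)

theorem card_ltPairs (n : ℕ) : (ltPairs n).card = n * (n - 1) / 2 := by
  have h : (ltPairs n).card = ∑ y : Fin n, y.val := by
    rw [Finset.card_eq_sum_ones, ltPairs, Finset.sum_filter, ← Finset.univ_product_univ,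
      Finset.sum_product_right]
    refine Finset.sum_congr rfl fun y _ => ?_
    rw [← Finset.sum_filter, ← Finset.card_eq_sum_ones]
    simp [Finset.filter_gt_eq_Iio]
  rw [h, Fin.sum_univ_eq_sum_range (fun y => y) n, Finset.sum_range_id]

theorem prod_ltPairs_X (n : ℕ) :
    ∏ p ∈ ltPairs n, (X (Fin.rev p.2) : R n) = ∏ i : Fin n, X i ^ (n - 1 - i.val) := by
  rw [← Equiv.prod_comp Fin.revPerm, ltPairs, Finset.prod_filter, ← Finset.univ_product_univ,
    Finset.prod_product_right]
  refine Finset.prod_congr rfl fun y _ => ?_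
  rw [← Finset.prod_filter]
  change ∏ _a with _a < y, X (Fin.rev y) = X (Fin.rev y) ^ (n - 1 - (Fin.rev y).val)
  have h : n - 1 - (n - (y.val + 1)) = y.val := by omega
  simp [Finset.filter_gt_eq_Iio, Fin.val_rev, h]

theorem invPairs_mul_simpleSwap (v : Equiv.Perm (Fin n)) (i : ℕ) (h : i + 1 < n)
    (hv : v ⟨i, by omega⟩ < v ⟨i + 1, h⟩) :
    invPairs (v * simpleSwap i h) =
      insert (v ⟨i, by omega⟩, v ⟨i + 1, h⟩) (invPairs v) := by
  ext ⟨x, y⟩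
  obtain ⟨p, rfl⟩ := v.surjective x
  obtain ⟨q, rfl⟩ := v.surjective y
  simp only [invPairs, ltPairs, Finset.mem_filter, Finset.mem_univ, true_and, Finset.mem_insert,
    mul_inv_rev, Equiv.Perm.mul_apply, Equiv.Perm.coe_inv, Equiv.symm_apply_apply,
    Equiv.symm_swap, Prod.mk.injEq, EmbeddingLike.apply_eq_iff_eq]
  have hne : ¬(q = ⟨i, by omega⟩ ∧ p = ⟨i + 1, h⟩ ∧ v p < v q) := by
    rintro ⟨rfl, rfl, h1⟩
    exact hv.not_gt h1
  have heq : p = ⟨i, by omega⟩ ∧ q = ⟨i + 1, h⟩ → v p < v q := by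
    rintro ⟨rfl, rfl⟩
    exact hv
  simp only [Equiv.swap_apply_def]
  generalize (v p < v q) = r at hne heq ⊢
  obtain ⟨p, hp⟩ := p
  obtain ⟨q, hq⟩ := q
  simp only [Fin.mk.injEq] at *
  split_ifs <;> simp only [Fin.mk_lt_mk] <;> grind

theorem notMem_invPairs (v : Equiv.Perm (Fin n)) (i : ℕ) (h : i + 1 < n) :
    (v ⟨i, by omega⟩, v ⟨i + 1, h⟩) ∉ invPairs v := by
  simp [invPairs]

theorem card_invPairs_mul_of_lt (v : Equiv.Perm (Fin n)) (i : ℕ) (h : i + 1 < n)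
    (hv : v ⟨i, by omega⟩ < v ⟨i + 1, h⟩) :
    (invPairs (v * simpleSwap i h)).card = (invPairs v).card + 1 := by
  rw [invPairs_mul_simpleSwap v i h hv, Finset.card_insert_of_notMem (notMem_invPairs v i h)]

theorem invProd_mul_of_lt (v : Equiv.Perm (Fin n)) (i : ℕ) (h : i + 1 < n)
    (hv : v ⟨i, by omega⟩ < v ⟨i + 1, h⟩) :
    invProd (v * simpleSwap i h) =
      (((v ⟨i + 1, h⟩).val : ℤ) - (v ⟨i, by omega⟩).val) * invProd v := by
  rw [invProd, invPairs_mul_simpleSwap v i h hv, Finset.prod_insert (notMem_invPairs v i h),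
    invProd]

theorem card_invPairs_mul_of_gt (v : Equiv.Perm (Fin n)) (i : ℕ) (h : i + 1 < n)
    (hv : v ⟨i + 1, h⟩ < v ⟨i, by omega⟩) :
    (invPairs (v * simpleSwap i h)).card + 1 = (invPairs v).card := by
  have := card_invPairs_mul_of_lt (v * simpleSwap i h) i h (by simpa using hv)
  rw [← this, mul_assoc, Equiv.swap_mul_self, mul_one]

theorem apply_lt_or_gt (v : Equiv.Perm (Fin n)) (i : ℕ) (h : i + 1 < n) :
    v ⟨i, by omega⟩ < v ⟨i + 1, h⟩ ∨ v ⟨i + 1, h⟩ < v ⟨i, by omega⟩ :=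
  lt_or_gt_of_ne fun e => by simp at e

theorem card_invPairs_mul_le (v : Equiv.Perm (Fin n)) (i : ℕ) (h : i + 1 < n) :
    (invPairs (v * simpleSwap i h)).card ≤ (invPairs v).card + 1 := by
  rcases apply_lt_or_gt v i h with hv | hv
  · exact (card_invPairs_mul_of_lt v i h hv).le
  · have := card_invPairs_mul_of_gt v i h hv
    omega

theorem card_invPairs_le (v : Equiv.Perm (Fin n)) : (invPairs v).card ≤ (ltPairs n).card :=
  Finset.card_filter_le _ _

theorem permOfWord_cons (i : ℕ) (h : i + 1 < n) (l : List ℕ) :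
    permOfWord n (i :: l) = simpleSwap i h * permOfWord n l := by
  simp [permOfWord, h]

theorem card_invPairs_mul_permOfWord_le (l : List ℕ) (hl : ∀ i ∈ l, i + 1 < n)
    (v : Equiv.Perm (Fin n)) :
    (invPairs (v * permOfWord n l)).card ≤ (invPairs v).card + l.length := by
  induction l generalizing v with
  | nil => simp [permOfWord]
  | cons i l ih =>
    have hi := hl i (by simp)
    have h1 := ih (fun j hj => hl j (by simp [hj])) (v * simpleSwap i hi)
    have h2 := card_invPairs_mul_le v i hi
    rw [permOfWord_cons i hi, ← mul_assoc, List.length_cons]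
    omega

theorem invPairs_revPerm : invPairs (Fin.revPerm : Equiv.Perm (Fin n)) = ltPairs n := by
  refine Finset.filter_true_of_mem fun p hp => ?_
  have : p.1 < p.2 := by simpa [ltPairs] using hp
  change Fin.rev p.2 < Fin.rev p.1
  simpa using this

theorem invPairs_one : invPairs (1 : Equiv.Perm (Fin n)) = ∅ := by
  refine Finset.filter_false_of_mem fun p hp => ?_
  have : p.1 < p.2 := by simpa [ltPairs] using hp
  simpa using this.le

theorem eq_revPerm_of_forall_gt (v : Equiv.Perm (Fin n))
    (hv : ∀ (i : ℕ) (h : i + 1 < n), v ⟨i + 1, h⟩ < v ⟨i, by omega⟩) : v = Fin.revPerm := by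
  cases n with
  | zero => exact Subsingleton.elim _ _
  | succ m =>
    have hanti : StrictAnti v := Fin.strictAnti_iff_succ_lt.2 fun i => hv i.val (by omega)
    have hmono : StrictMono fun a => Fin.rev (v a) := fun a b hab => Fin.rev_lt_rev.2 (hanti hab)
    have hsurj : Function.Surjective fun a => Fin.rev (v a) :=
      Fin.rev_surjective.comp v.surjective
    ext1 a
    have := congrArg (fun e => Fin.rev (e a)) (Subsingleton.elim
      (hmono.orderIsoOfSurjective _ hsurj) (OrderIso.refl (Fin (m + 1))))
    simpa using this

theorem exists_word_mul_eq_revPerm (k : ℕ) (v : Equiv.Perm (Fin n))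
    (hv : (invPairs v).card + k = (ltPairs n).card) :
    ∃ l : List ℕ, (∀ i ∈ l, i + 1 < n) ∧ l.length = k ∧ v * permOfWord n l = Fin.revPerm := by
  induction k generalizing v with
  | zero =>
    refine ⟨[], by simp, rfl, ?_⟩
    rw [permOfWord, List.map_nil, List.prod_nil, mul_one]
    refine eq_revPerm_of_forall_gt v fun i h => (apply_lt_or_gt v i h).resolve_left fun hlt => ?_
    have h1 := card_invPairs_mul_of_lt v i h hlt
    have h2 := card_invPairs_le (v * simpleSwap i h)
    omega
  | succ k ih =>
    obtain ⟨i, h, hlt⟩ : ∃ (i : ℕ) (h : i + 1 < n), v ⟨i, by omega⟩ < v ⟨i + 1, h⟩ := by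
      by_contra! hcon
      have : v = Fin.revPerm := eq_revPerm_of_forall_gt v fun i h =>
        (apply_lt_or_gt v i h).resolve_left (hcon i h).not_gt
      rw [this, invPairs_revPerm] at hv
      omega
    obtain ⟨l, hl, hlen, hprod⟩ := ih (v * simpleSwap i h)
      (by rw [card_invPairs_mul_of_lt v i h hlt]; omega)
    refine ⟨i :: l, ?_, by simp [hlen], by rw [permOfWord_cons i h, ← mul_assoc, hprod]⟩
    simpa using ⟨h, hl⟩

theorem IsReducedWordFor.length_eq {l : List ℕ} (hl : IsReducedWordFor n l Fin.revPerm) :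
    l.length = (ltPairs n).card := by
  obtain ⟨hmem, hprod, hmin⟩ := hl
  obtain ⟨l', hl', hlen, hprod'⟩ := exists_word_mul_eq_revPerm (ltPairs n).card
    (1 : Equiv.Perm (Fin n)) (by simp [invPairs_one])
  rw [one_mul] at hprod'
  have h1 := hmin l' hl' hprod'
  have h2 := card_invPairs_mul_permOfWord_le l hmem 1
  rw [one_mul, hprod, invPairs_revPerm, invPairs_one, Finset.card_empty] at h2
  omega

theorem evalPerm_deformedStaircase_revPerm :
    evalPerm Fin.revPerm (deformedStaircase n) = invProd (Fin.revPerm : Equiv.Perm (Fin n)) := by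
  simp [-Fin.val_rev, deformedStaircase, evalPerm, invProd, invPairs_revPerm]

theorem evalPerm_deformedStaircase_of_ne {v : Equiv.Perm (Fin n)} (hv : v ≠ Fin.revPerm) :
    evalPerm v (deformedStaircase n) = 0 := by
  contrapose! hv
  have hne : ∀ y x : Fin n, x < y → v (Fin.rev y) ≠ x := by
    intro y x hxy he
    refine hv ?_
    rw [deformedStaircase, map_prod]
    exact Finset.prod_eq_zero (i := (x, y)) (by simpa [ltPairs] using hxy)
      (by simp [evalPerm, he])
  have hle : ∀ y ∈ Finset.univ, y.val ≤ (v (Fin.rev y)).val := fun y _ =>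
    not_lt.1 fun hlt => hne y _ hlt rfl
  have hsum : ∑ y : Fin n, y.val = ∑ y : Fin n, (v (Fin.rev y)).val :=
    (Equiv.sum_comp (Fin.revPerm.trans v) fun y => y.val).symm
  have heq := (Finset.sum_eq_sum_iff_of_le hle).1 hsum
  ext a
  simpa using (heq (Fin.rev a) (Finset.mem_univ _)).symm

theorem evalPerm_rename (v s : Equiv.Perm (Fin n)) (P : R n) :
    evalPerm v (rename s P) = evalPerm (v * s) P := by
  simp [evalPerm, eval_rename, Function.comp_def]

theorem X_sub_X_ne_zero (i : ℕ) (h : i + 1 < n) :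
    (X (⟨i, by omega⟩ : Fin n) - X ⟨i + 1, h⟩ : R n) ≠ 0 :=
  sub_ne_zero.2 fun e => by simpa using X_injective e

theorem totalDegree_X_sub_X (i : ℕ) (h : i + 1 < n) :
    (X (⟨i, by omega⟩ : Fin n) - X ⟨i + 1, h⟩ : R n).totalDegree = 1 :=
  ((isHomogeneous_X ℤ _).sub (isHomogeneous_X ℤ _)).totalDegree (X_sub_X_ne_zero i h)

namespace IsOppDemFamily

variable {D : ℕ → R n → R n} (hD : IsOppDemFamily D)
include hD

theorem map_sub (i : ℕ) (h : i + 1 < n) (P Q : R n) : D i (P - Q) = D i P - D i Q := by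
  apply mul_left_cancel₀ (X_sub_X_ne_zero i h)
  rw [mul_sub, hD i h, hD i h, hD i h, _root_.map_sub]
  ring

theorem totalDegree_le (i : ℕ) (h : i + 1 < n) (P : R n) :
    D i P = 0 ∨ (D i P).totalDegree + 1 ≤ P.totalDegree := by
  refine or_iff_not_imp_left.2 fun h0 => ?_
  have h1 := totalDegree_mul_of_isDomain (X_sub_X_ne_zero i h) h0
  rw [hD i h, totalDegree_X_sub_X] at h1
  have h2 := totalDegree_sub P (rename (simpleSwap i h) P)
  have h3 := totalDegree_rename_le (simpleSwap i h) P
  rw [max_eq_left h3] at h2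
  omega

theorem map_zero (i : ℕ) (h : i + 1 < n) : D i 0 = 0 := by
  simpa using hD.map_sub i h 0 0

theorem applyWord_sub (l : List ℕ) (hl : ∀ i ∈ l, i + 1 < n) (P Q : R n) :
    applyWord D l (P - Q) = applyWord D l P - applyWord D l Q := by
  induction l with
  | nil => rfl
  | cons i l ih =>
    change D i (applyWord D l (P - Q)) = D i (applyWord D l P) - D i (applyWord D l Q)
    rw [ih fun j hj => hl j (by simp [hj]), hD.map_sub i (hl i (by simp))]

theorem totalDegree_applyWord_le (l : List ℕ) (hl : ∀ i ∈ l, i + 1 < n) (P : R n) :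
    applyWord D l P = 0 ∨ (applyWord D l P).totalDegree + l.length ≤ P.totalDegree := by
  induction l with
  | nil => exact Or.inr le_rfl
  | cons i l ih =>
    have hi := hl i (by simp)
    change D i (applyWord D l P) = 0 ∨ (D i (applyWord D l P)).totalDegree + _ ≤ _
    rcases ih fun j hj => hl j (by simp [hj]) with h | h
    · rw [h]
      exact Or.inl (hD.map_zero i hi)
    · refine (hD.totalDegree_le i hi (applyWord D l P)).imp_right fun h' => ?_
      rw [List.length_cons]
      omega

theorem evalPerm_eq (i : ℕ) (h : i + 1 < n) (v : Equiv.Perm (Fin n)) (P : R n) :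
    (((v ⟨i, by omega⟩).val : ℤ) - (v ⟨i + 1, h⟩).val) * evalPerm v (D i P) =
      evalPerm v P - evalPerm (v * simpleSwap i h) P := by
  have := congrArg (evalPerm v) (hD i h P)
  rw [_root_.map_sub, evalPerm_rename] at this
  simpa [evalPerm] using this

theorem evalPerm_applyWord_eq_zero (l : List ℕ) (hl : ∀ i ∈ l, i + 1 < n)
    (v : Equiv.Perm (Fin n)) (hv : (invPairs v).card + l.length < (ltPairs n).card) :
    evalPerm v (applyWord D l (deformedStaircase n)) = 0 := by
  induction l generalizing v with
  | nil =>
    refine evalPerm_deformedStaircase_of_ne fun h => ?_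
    simp [h, invPairs_revPerm] at hv
  | cons i l ih =>
    have hi := hl i (by simp)
    have hl' : ∀ j ∈ l, j + 1 < n := fun j hj => hl j (by simp [hj])
    rw [List.length_cons] at hv
    have h1 := hD.evalPerm_eq i hi v (applyWord D l (deformedStaircase n))
    have h2 := card_invPairs_mul_le v i hi
    rw [ih hl' v (by omega), ih hl' (v * simpleSwap i hi) (by omega), sub_zero] at h1
    refine (mul_eq_zero.1 h1).resolve_left fun h0 => ?_
    rcases apply_lt_or_gt v i hi with h | h <;> rw [Fin.lt_def] at h <;> omega

theorem evalPerm_applyWord_eq_invProd (l : List ℕ) (hl : ∀ i ∈ l, i + 1 < n)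
    (v : Equiv.Perm (Fin n)) (hprod : v * permOfWord n l = Fin.revPerm)
    (hv : (invPairs v).card + l.length = (ltPairs n).card) :
    evalPerm v (applyWord D l (deformedStaircase n)) = invProd v := by
  induction l generalizing v with
  | nil =>
    have : v = Fin.revPerm := by simpa [permOfWord] using hprod
    rw [this]
    exact evalPerm_deformedStaircase_revPerm
  | cons i l ih =>
    have hi := hl i (by simp)
    have hl' : ∀ j ∈ l, j + 1 < n := fun j hj => hl j (by simp [hj])
    rw [List.length_cons] at hv
    rw [permOfWord_cons i hi, ← mul_assoc] at hprod
    have hle := card_invPairs_mul_permOfWord_le l hl' (v * simpleSwap i hi)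
    rw [hprod, invPairs_revPerm] at hle
    have hlt : v ⟨i, by omega⟩ < v ⟨i + 1, hi⟩ :=
      (apply_lt_or_gt v i hi).resolve_right fun hgt => by
        have := card_invPairs_mul_of_gt v i hi hgt
        omega
    have hcard := card_invPairs_mul_of_lt v i hi hlt
    have h1 := hD.evalPerm_eq i hi v (applyWord D l (deformedStaircase n))
    rw [hD.evalPerm_applyWord_eq_zero l hl' v (by omega),
      ih hl' (v * simpleSwap i hi) hprod (by omega), invProd_mul_of_lt v i hi hlt] at h1
    have hne : ((v ⟨i, by omega⟩).val : ℤ) - (v ⟨i + 1, hi⟩).val ≠ 0 := by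
      rw [Fin.lt_def] at hlt
      omega
    apply mul_left_cancel₀ hne
    change _ * evalPerm v (D i (applyWord D l (deformedStaircase n))) = _
    rw [h1]
    ring

end IsOppDemFamily

theorem totalDegree_prod_X_sub_C_le {ι : Type*} (s : Finset ι) (f : ι → Fin n) (c : ι → ℤ) :
    (∏ p ∈ s, (X (f p) - C (c p)) : R n).totalDegree ≤ s.card := by
  refine (totalDegree_finsetProd _ _).trans ?_
  rw [Finset.card_eq_sum_ones]
  refine Finset.sum_le_sum fun p _ => (totalDegree_sub_C_le _ _).trans ?_
  rw [totalDegree_X]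

theorem totalDegree_prod_X_sub_C_sub_le {ι : Type*} (s : Finset ι) (f : ι → Fin n) (c : ι → ℤ) :
    (∏ p ∈ s, (X (f p) - C (c p)) - ∏ p ∈ s, X (f p) : R n) = 0 ∨
      (∏ p ∈ s, (X (f p) - C (c p)) - ∏ p ∈ s, X (f p) : R n).totalDegree + 1 ≤ s.card := by
  classical
  induction s using Finset.induction_on with
  | empty => simp
  | insert a s ha ih =>
    right
    rw [Finset.prod_insert ha, Finset.prod_insert ha, Finset.card_insert_of_notMem ha]
    set A : R n := ∏ p ∈ s, (X (f p) - C (c p))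
    set B : R n := ∏ p ∈ s, X (f p)
    have hsplit : (X (f a) - C (c a)) * A - X (f a) * B = X (f a) * (A - B) - C (c a) * A := by
      ring
    have h1 : (C (c a) * A).totalDegree ≤ s.card := by
      refine (totalDegree_mul _ _).trans ?_
      rw [totalDegree_C, zero_add]
      exact totalDegree_prod_X_sub_C_le s f c
    have h2 : (X (f a) * (A - B)).totalDegree ≤ s.card := by
      rcases ih with h | h
      · simp [h]
      · refine (totalDegree_mul _ _).trans ?_
        rw [totalDegree_X]
        omega
    rw [hsplit]
    exact Nat.succ_le_succ ((totalDegree_sub _ _).trans (max_le h2 h1))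

theorem IsOppDemFamily.applyWord_staircase {D : ℕ → R n → R n} (hD : IsOppDemFamily D)
    {l : List ℕ} (hl : IsReducedWordFor n l Fin.revPerm) :
    applyWord D l (∏ i : Fin n, X i ^ (n - 1 - i.val)) = 1 := by
  have hlen := hl.length_eq
  obtain ⟨hmem, hprod, -⟩ := hl
  have hdeg : (deformedStaircase n).totalDegree ≤ (ltPairs n).card :=
    totalDegree_prod_X_sub_C_le (ltPairs n) (fun p => Fin.rev p.2) fun p => (p.1.val : ℤ)
  have hconst : (applyWord D l (deformedStaircase n)).totalDegree = 0 := by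
    rcases hD.totalDegree_applyWord_le l hmem (deformedStaircase n) with h | h
    · rw [h, totalDegree_zero]
    · omega
  have hone : applyWord D l (deformedStaircase n) = 1 := by
    have h1 := hD.evalPerm_applyWord_eq_invProd l hmem 1 (by rw [one_mul, hprod])
      (by rw [invPairs_one, hlen, Finset.card_empty, zero_add])
    rw [totalDegree_eq_zero_iff_eq_C.1 hconst] at h1 ⊢
    simp only [evalPerm, eval_C, invProd, invPairs_one, Finset.prod_empty] at h1
    rw [h1, C_1]
  have hzero : applyWord D l (deformedStaircase n - ∏ p ∈ ltPairs n, X (Fin.rev p.2)) = 0 := by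
    rcases totalDegree_prod_X_sub_C_sub_le (n := n) (ltPairs n) (fun p => Fin.rev p.2)
      (fun p => (p.1.val : ℤ)) with h | h
    · rw [deformedStaircase, h]
      simpa using hD.applyWord_sub l hmem 0 0
    · refine (hD.totalDegree_applyWord_le l hmem _).resolve_right fun h' => ?_
      rw [deformedStaircase] at h'
      omega
  rw [hD.applyWord_sub l hmem, hone, prod_ltPairs_X, sub_eq_zero] at hzero
  exact hzero.symm

theorem IsDemFamily.neg {D : ℕ → R n → R n} (hD : IsDemFamily D) :
    IsOppDemFamily fun i P => -D i P := by
  intro i h P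
  rw [← hD i h P]
  ring

theorem IsDemFamily.applyWord_eq {D : ℕ → R n → R n} (hD : IsDemFamily D)
    (l : List ℕ) (hl : ∀ i ∈ l, i + 1 < n) (P : R n) :
    applyWord D l P = C ((-1) ^ l.length) * applyWord (fun i P => -D i P) l P := by
  induction l with
  | nil => simp [applyWord]
  | cons i l ih =>
    have hneg (Q : R n) : D i (-Q) = -D i Q := by
      have hi := hl i (by simp)
      have h := hD.neg.map_sub i hi 0 Q
      rw [hD.neg.map_zero i hi, zero_sub, zero_sub] at h
      exact neg_injective h
    change D i (applyWord D l P) = _ * -D i (applyWord (fun i P => -D i P) l P)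
    rw [ih fun j hj => hl j (by simp [hj]), List.length_cons, pow_succ]
    rcases neg_one_pow_eq_or ℤ l.length with h | h <;> simp [h, hneg]

end Dem

open Dem in
/-- `∂_{w₀}(X_1^{n-1} X_2^{n-2} ⋯ X_n^0) = (-1)^{n(n-1)/2}`;
equivalently, for the opposite-sign Demazure operators `∂'_i`
(`(X_i - X_{i+1})·∂'_i P = P - s_i P`), one has
`∂'_{w₀}(X_1^{n-1} ⋯ X_{n-1}) = 1`. -/
theorem statement13 (n : ℕ) (hn : 1 ≤ n)
    (D : ℕ → R n → R n) (hD : IsDemFamily D)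
    (l : List ℕ) (hl : IsReducedWordFor n l Fin.revPerm)
    (D' : ℕ → R n → R n)
    (hD' : ∀ (i : ℕ) (h : i + 1 < n) (P : R n),
      (MvPolynomial.X (⟨i, by omega⟩ : Fin n) - MvPolynomial.X ⟨i + 1, h⟩) * D' i P
        = P - MvPolynomial.rename (Equiv.swap (⟨i, by omega⟩ : Fin n) ⟨i + 1, h⟩) P)
    (l' : List ℕ) (hl' : IsReducedWordFor n l' Fin.revPerm) :
    applyWord D l (∏ i : Fin n, MvPolynomial.X i ^ (n - 1 - i.val))
        = MvPolynomial.C ((-1 : ℤ) ^ (n * (n - 1) / 2)) ∧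
    applyWord D' l' (∏ i : Fin n, MvPolynomial.X i ^ (n - 1 - i.val)) = 1 := by
  refine ⟨?_, IsOppDemFamily.applyWord_staircase hD' hl'⟩
  rw [hD.applyWord_eq l hl.1, hD.neg.applyWord_staircase hl, mul_one, hl.length_eq, card_ltPairs]
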